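/- Let n ≥ 2, let λ = (λ_1,…,λ_n) ∈ ℂⁿ with Re λ_i > 0 for all i, let μ ∈ ℂ with Re μ > 0, and set ν = λ_2 + ⋯ + λ_n + μ. Then for every continuous function φ : [0,1] → ℂ, (1/Γ(μ)) ∫_{Δ_n} (∏_{i=1}^n t_i^{λ_i−1}) (1−|t|)^{μ−1} φ(t_1) dt = [Γ(λ_2)⋯Γ(λ_n)/Γ(ν)] ∫_0^1 s^{λ_1−1} (1−s)^{ν−1} φ(s) ds, both integrals being absolutely convergent. (This expresses the n-variable transform K^{μ,λ} of a function of the first variable alone as a one-variable Riemann–Liouville type transform.) -/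

import Mathlib

open MeasureTheory Complex

noncomputable section

/-- The open simplex `{t ∈ ℝⁿ : tᵢ > 0, t₁ + ⋯ + tₙ < 1}`. -/
def openSimplex (n : ℕ) : Set (Fin n → ℝ) := {t | (∀ i, 0 < t i) ∧ ∑ i, t i < 1}

/-- The open simplex of size `c`. -/
def scaledSimplex (n : ℕ) (c : ℝ) : Set (Fin n → ℝ) := {t | (∀ i, 0 < t i) ∧ ∑ i, t i < c}

/-- The unnormalised complex Dirichlet density on the simplex of size `c`. -/
def dirichletDensity {n : ℕ} (a : Fin n → ℂ) (μ : ℂ) (c : ℝ) (t : Fin n → ℝ) : ℂ :=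
  (∏ i, (t i : ℂ) ^ (a i - 1)) * ((c - ∑ i, t i : ℝ) : ℂ) ^ (μ - 1)

/-- The mass of the Dirichlet density on the unit simplex. -/
def dirichletMass {n : ℕ} (a : Fin n → ℂ) (μ : ℂ) : ℂ :=
  (∏ i, Gamma (a i)) * Gamma μ / Gamma (∑ i, a i + μ)

theorem measurableSet_scaledSimplex (n : ℕ) (c : ℝ) : MeasurableSet (scaledSimplex n c) := by
  have h : scaledSimplex n c = (⋂ i, {t | 0 < t i}) ∩ {t | ∑ i, t i < c} := by
    ext t; simp [scaledSimplex]
  rw [h]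
  exact (MeasurableSet.iInter fun i => measurableSet_lt (by fun_prop) (by fun_prop)).inter
    (measurableSet_lt (by fun_prop) (by fun_prop))

theorem measurableSet_scaledSimplex_slice (n : ℕ) (c : ℝ) :
    MeasurableSet {p : ℝ × (Fin n → ℝ) | p.2 ∈ scaledSimplex n (c - p.1)} := by
  have h : {p : ℝ × (Fin n → ℝ) | p.2 ∈ scaledSimplex n (c - p.1)} =
      (⋂ i, {p | 0 < p.2 i}) ∩ {p | ∑ i, p.2 i < c - p.1} := by
    ext t; simp [scaledSimplex]
  rw [h]
  exact (MeasurableSet.iInter fun i => measurableSet_lt (by fun_prop) (by fun_prop)).inter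
    (measurableSet_lt (by fun_prop) (by fun_prop))

theorem measurable_dirichletDensity_slice {n : ℕ} (a : Fin n → ℂ) (μ : ℂ) (c : ℝ) :
    Measurable fun p : ℝ × (Fin n → ℝ) => dirichletDensity a μ (c - p.1) p.2 := by
  unfold dirichletDensity
  refine (Finset.measurable_prod _ fun i _ => ?_).mul ?_
  · exact Measurable.pow_const (by fun_prop) _
  · exact Measurable.pow_const (by fun_prop) _

theorem integrableOn_beta_mul {u v : ℂ} (hu : 0 < u.re) (hv : 0 < v.re) {c : ℝ} (hc : 0 < c)
    {φ : ℝ → ℂ} (hφ : ContinuousOn φ (Set.Icc 0 c)) :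
    IntegrableOn (fun x : ℝ => (x : ℂ) ^ (u - 1) * ((c - x : ℝ) : ℂ) ^ (v - 1) * φ x)
      (Set.Ioo 0 c) := by
  have h1 := (betaIntegral_convergent hu hv).comp_mul_left (c := c⁻¹)
  have h2 : IntegrableOn (fun x : ℝ => (x : ℂ) ^ (u - 1) * ((c - x : ℝ) : ℂ) ^ (v - 1))
      (Set.Icc 0 c) := by
    rw [integrableOn_Icc_iff_integrableOn_Ioc, ← intervalIntegrable_iff_integrableOn_Ioc_of_le hc.le]
    have h3 := h1.const_mul ((c : ℂ) ^ (u - 1) * (c : ℂ) ^ (v - 1))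
    simp only [zero_div, one_div, inv_inv] at h3
    refine h3.congr ?_
    intro x hx
    rw [Set.uIoc_of_le hc.le] at hx
    have e1 : ((c⁻¹ * x : ℝ) : ℂ) ^ (u - 1) * (c : ℂ) ^ (u - 1) = (x : ℂ) ^ (u - 1) := by
      rw [← mul_cpow_ofReal_nonneg (mul_nonneg (inv_nonneg.2 hc.le) hx.1.le) hc.le, ← ofReal_mul]
      congr 2; field_simp
    have e2 : ((1 - c⁻¹ * x : ℝ) : ℂ) ^ (v - 1) * (c : ℂ) ^ (v - 1) =
        ((c - x : ℝ) : ℂ) ^ (v - 1) := by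
      have : 0 ≤ 1 - c⁻¹ * x := by
        rw [sub_nonneg, inv_mul_le_iff₀ hc]; linarith [hx.2]
      rw [← mul_cpow_ofReal_nonneg this hc.le, ← ofReal_mul]
      congr 2; field_simp
    beta_reduce
    rw [← e1, ← e2]
    push_cast
    ring
  exact (h2.mul_continuousOn hφ isCompact_Icc).mono_set Set.Ioo_subset_Icc_self

theorem setIntegral_beta {u v : ℂ} (hu : 0 < u.re) (hv : 0 < v.re) {c : ℝ} (hc : 0 < c) :
    ∫ x in Set.Ioo (0 : ℝ) c, (x : ℂ) ^ (u - 1) * ((c - x : ℝ) : ℂ) ^ (v - 1) =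
      (c : ℂ) ^ (u + v - 1) * (Gamma u * Gamma v / Gamma (u + v)) := by
  have h := betaIntegral_scaled u v hc
  rw [intervalIntegral.integral_of_le hc.le, integral_Ioc_eq_integral_Ioo] at h
  have hne : Gamma (u + v) ≠ 0 := Gamma_ne_zero_of_re_pos (by simp; linarith)
  rw [Gamma_mul_Gamma_eq_betaIntegral hu hv, mul_div_cancel_left₀ _ hne, ← h]
  simp

/-- Integrability and the mass formula for the Dirichlet density on every scaled simplex. -/
def DirichletFormula (n : ℕ) : Prop :=
  ∀ (a : Fin n → ℂ) (μ : ℂ) (c : ℝ), (∀ i, 0 < (a i).re) → 0 < μ.re → 0 < c →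
    IntegrableOn (dirichletDensity a μ c) (scaledSimplex n c) ∧
    ∫ t in scaledSimplex n c, dirichletDensity a μ c t =
      (c : ℂ) ^ (∑ i, a i + μ - 1) * dirichletMass a μ

theorem DirichletFormula.integral_norm {n : ℕ} (H : DirichletFormula n) (a : Fin n → ℂ) (μ : ℂ)
    {c : ℝ} (ha : ∀ i, 0 < (a i).re) (hμ : 0 < μ.re) (hc : 0 < c) :
    ∫ t in scaledSimplex n c, ‖dirichletDensity a μ c t‖ =
      ‖(c : ℂ) ^ (∑ i, a i + μ - 1)‖ *
        ‖dirichletMass (fun i => ((a i).re : ℂ)) (μ.re : ℂ)‖ := by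
  have h := (H (fun i => ((a i).re : ℂ)) (μ.re : ℂ) c (by simpa using ha) (by simpa using hμ) hc).2
  have e : ∫ t in scaledSimplex n c, dirichletDensity (fun i => ((a i).re : ℂ)) (μ.re : ℂ) c t =
      ((∫ t in scaledSimplex n c, ‖dirichletDensity a μ c t‖ : ℝ) : ℂ) := by
    rw [← integral_complex_ofReal]
    refine setIntegral_congr_fun (measurableSet_scaledSimplex n c) fun t ht => ?_
    simp only [dirichletDensity, norm_mul, norm_prod]
    rw [norm_cpow_eq_rpow_re_of_pos (sub_pos.2 ht.2), ofReal_mul, ofReal_prod,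
      ofReal_cpow (sub_pos.2 ht.2).le]
    congr 1
    · refine Finset.prod_congr rfl fun i _ => ?_
      rw [norm_cpow_eq_rpow_re_of_pos (ht.1 i), ofReal_cpow (ht.1 i).le]
      simp
    · simp
  rw [e] at h
  have h' := congrArg norm h
  rw [norm_real, Real.norm_of_nonneg (integral_nonneg fun _ => norm_nonneg _), norm_mul] at h'
  rw [h', norm_cpow_eq_rpow_re_of_pos hc, norm_cpow_eq_rpow_re_of_pos hc]
  simp

theorem indicator_dirichletDensity_cons {n : ℕ} (a : Fin (n + 1) → ℂ) (μ : ℂ) (c : ℝ)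
    (φ : ℝ → ℂ) (x : ℝ) (y : Fin n → ℝ) :
    (scaledSimplex (n + 1) c).indicator (fun t => dirichletDensity a μ c t * φ (t 0))
        (Fin.cons x y) =
      (Set.Ioo 0 c).indicator (fun s : ℝ => (s : ℂ) ^ (a 0 - 1) * φ s) x *
        (scaledSimplex n (c - x)).indicator
          (dirichletDensity (fun i => a i.succ) μ (c - x)) y := by
  have key : (Fin.cons x y : Fin (n + 1) → ℝ) ∈ scaledSimplex (n + 1) c ↔
      x ∈ Set.Ioo 0 c ∧ y ∈ scaledSimplex n (c - x) := by
    simp only [scaledSimplex, Set.mem_ofPred_eq, Fin.forall_fin_succ, Fin.cons_zero, Fin.cons_succ,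
      Fin.sum_univ_succ, Set.mem_Ioo]
    constructor
    · rintro ⟨⟨h0, h1⟩, h2⟩
      have := Finset.sum_nonneg fun i (_ : i ∈ Finset.univ) => (h1 i).le
      exact ⟨⟨h0, by linarith⟩, h1, by linarith⟩
    · rintro ⟨⟨h0, -⟩, h1, h2⟩
      exact ⟨⟨h0, h1⟩, by linarith⟩
  by_cases h : x ∈ Set.Ioo 0 c ∧ y ∈ scaledSimplex n (c - x)
  · rw [Set.indicator_of_mem (key.2 h), Set.indicator_of_mem h.1, Set.indicator_of_mem h.2]
    simp only [dirichletDensity, Fin.prod_univ_succ, Fin.sum_univ_succ, Fin.cons_zero,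
      Fin.cons_succ, sub_sub]
    ring
  · rw [Set.indicator_of_notMem (mt key.1 h)]
    rcases not_and_or.1 h with h | h
    · rw [Set.indicator_of_notMem h, zero_mul]
    · rw [Set.indicator_of_notMem h, mul_zero]

theorem DirichletFormula.succ_mul {n : ℕ} (H : DirichletFormula n) (a : Fin (n + 1) → ℂ) (μ : ℂ)
    {c : ℝ} (ha : ∀ i, 0 < (a i).re) (hμ : 0 < μ.re) (hc : 0 < c) {φ : ℝ → ℂ}
    (hφ : ContinuousOn φ (Set.Icc 0 c)) :
    IntegrableOn (fun t => dirichletDensity a μ c t * φ (t 0)) (scaledSimplex (n + 1) c) ∧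
    ∫ t in scaledSimplex (n + 1) c, dirichletDensity a μ c t * φ (t 0) =
      dirichletMass (fun i => a i.succ) μ * ∫ s in Set.Ioo (0 : ℝ) c,
        (s : ℂ) ^ (a 0 - 1) * ((c - s : ℝ) : ℂ) ^ (∑ i : Fin n, a i.succ + μ - 1) * φ s := by
  set b : Fin n → ℂ := fun i => a i.succ
  have hbre : ∀ i, 0 < (b i).re := fun i => ha i.succ
  set ν : ℂ := ∑ i, b i + μ with hν
  have hνre : 0 < ν.re := by
    rw [hν, add_re, re_sum]
    exact add_pos_of_nonneg_of_pos (Finset.sum_nonneg fun i _ => (hbre i).le) hμ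
  set g : ℝ → ℂ := (Set.Ioo 0 c).indicator fun s : ℝ => (s : ℂ) ^ (a 0 - 1) * φ s with hg
  set h : ℝ → (Fin n → ℝ) → ℂ := fun x =>
    (scaledSimplex n (c - x)).indicator (dirichletDensity b μ (c - x)) with hh
  have hbeta := integrableOn_beta_mul (ha 0) hνre hc hφ
  have hgm : AEStronglyMeasurable g := by
    rw [hg, aestronglyMeasurable_indicator_iff measurableSet_Ioo]
    exact (Measurable.pow_const (by fun_prop) _).aestronglyMeasurable.mul
      ((hφ.mono Set.Ioo_subset_Icc_self).aestronglyMeasurable measurableSet_Ioo)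
  have hhm : Measurable fun p : ℝ × (Fin n → ℝ) => h p.1 p.2 :=
    (measurable_dirichletDensity_slice b μ c).indicator (measurableSet_scaledSimplex_slice n c)
  have hslice : ∀ x, ∫ y, g x * h x y = (Set.Ioo 0 c).indicator (fun s : ℝ =>
      dirichletMass b μ * ((s : ℂ) ^ (a 0 - 1) * ((c - s : ℝ) : ℂ) ^ (ν - 1) * φ s)) x := by
    intro x
    rw [integral_const_mul]
    by_cases hx : x ∈ Set.Ioo 0 c
    · rw [hg, Set.indicator_of_mem hx, Set.indicator_of_mem hx, hh,
        integral_indicator (measurableSet_scaledSimplex n _),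
        (H b μ (c - x) hbre hμ (sub_pos.2 hx.2)).2]
      ring
    · rw [hg, Set.indicator_of_notMem hx, Set.indicator_of_notMem hx, zero_mul]
  have hnorm : ∀ x, ∫ y, ‖g x * h x y‖ = (Set.Ioo 0 c).indicator (fun s : ℝ =>
      ‖dirichletMass (fun i => ((b i).re : ℂ)) (μ.re : ℂ)‖ *
        ‖(s : ℂ) ^ (a 0 - 1) * ((c - s : ℝ) : ℂ) ^ (ν - 1) * φ s‖) x := by
    intro x
    simp only [norm_mul]
    rw [integral_const_mul]
    by_cases hx : x ∈ Set.Ioo 0 c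
    · rw [hg, Set.indicator_of_mem hx, Set.indicator_of_mem hx, hh]
      simp only [norm_indicator_eq_indicator_norm]
      rw [integral_indicator (measurableSet_scaledSimplex n _),
        H.integral_norm b μ hbre hμ (sub_pos.2 hx.2), norm_mul]
      ring
    · rw [hg, Set.indicator_of_notMem hx, Set.indicator_of_notMem hx, norm_zero, zero_mul]
  have hint : Integrable (fun p : ℝ × (Fin n → ℝ) => g p.1 * h p.1 p.2)
      ((volume : Measure ℝ).prod volume) := by
    have hm : AEStronglyMeasurable (fun p : ℝ × (Fin n → ℝ) => g p.1 * h p.1 p.2)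
        ((volume : Measure ℝ).prod volume) := hgm.comp_fst.mul hhm.aestronglyMeasurable
    rw [integrable_prod_iff hm]
    refine ⟨Filter.Eventually.of_forall fun x => ?_, ?_⟩
    · by_cases hx : x ∈ Set.Ioo 0 c
      · exact ((integrable_indicator_iff (measurableSet_scaledSimplex n _)).2
          (H b μ (c - x) hbre hμ (sub_pos.2 hx.2)).1).const_mul (g x)
      · simp [hg, Set.indicator_of_notMem hx]
    · simp only [hnorm]
      exact (integrable_indicator_iff measurableSet_Ioo).2 (hbeta.norm.const_mul _)
  have hmp := (volume_preserving_piFinSuccAbove (fun _ : Fin (n + 1) => ℝ) 0).symm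
  have hemb := (MeasurableEquiv.piFinSuccAbove (fun _ : Fin (n + 1) => ℝ) 0).symm.measurableEmbedding
  set F := (scaledSimplex (n + 1) c).indicator fun t => dirichletDensity a μ c t * φ (t 0) with hF
  have hcomp : F ∘ (MeasurableEquiv.piFinSuccAbove (fun _ : Fin (n + 1) => ℝ) 0).symm =
      fun p : ℝ × (Fin n → ℝ) => g p.1 * h p.1 p.2 := by
    funext p
    rw [← indicator_dirichletDensity_cons a μ c φ p.1 p.2]
    simp [hF, MeasurableEquiv.piFinSuccAbove_symm_apply, Fin.insertNthEquiv]
  constructor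
  · rw [← integrable_indicator_iff (measurableSet_scaledSimplex _ _),
      ← hmp.integrable_comp_emb hemb, ← hF, hcomp]
    exact hint
  · rw [← integral_indicator (measurableSet_scaledSimplex _ _), ← hF,
      ← hmp.integral_comp hemb]
    change ∫ p, (F ∘ (MeasurableEquiv.piFinSuccAbove (fun _ : Fin (n + 1) => ℝ) 0).symm) p
      ∂((volume : Measure ℝ).prod volume) = _
    rw [hcomp, integral_prod _ hint]
    simp only [hslice]
    rw [integral_indicator measurableSet_Ioo, integral_const_mul]

theorem dirichletFormula (n : ℕ) : DirichletFormula n := by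
  induction n with
  | zero =>
    intro a μ c _ hμ hc
    have hS : scaledSimplex 0 c = Set.univ := by ext; simp [scaledSimplex, hc]
    rw [hS, integrableOn_univ, setIntegral_univ, volume_pi, Measure.pi_of_empty _ isEmptyElim]
    constructor
    · exact integrable_dirac (by simp)
    · simp [dirichletDensity, dirichletMass, Gamma_ne_zero_of_re_pos hμ]
  | succ n ih =>
    intro a μ c ha hμ hc
    have h := ih.succ_mul a μ ha hμ hc (φ := fun _ => 1) continuousOn_const
    simp only [mul_one] at h
    refine ⟨h.1, h.2.trans ?_⟩
    have hν : 0 < (∑ i : Fin n, a i.succ + μ).re := by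
      rw [add_re, re_sum]
      exact add_pos_of_nonneg_of_pos (Finset.sum_nonneg fun i _ => (ha i.succ).le) hμ
    have hne := Gamma_ne_zero_of_re_pos hν
    rw [setIntegral_beta (ha 0) hν hc]
    simp only [dirichletMass, Fin.prod_univ_succ, Fin.sum_univ_succ, add_assoc]
    field_simp

theorem stmt3 (n : ℕ) (hn : 2 ≤ n) (lam : Fin n → ℂ) (hlam : ∀ i, 0 < (lam i).re)
    (μ : ℂ) (hμ : 0 < μ.re) (φ : ℝ → ℂ) (hφ : ContinuousOn φ (Set.Icc 0 1)) :
    let i0 : Fin n := ⟨0, by omega⟩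
    let ν : ℂ := (∑ i ∈ Finset.univ.erase i0, lam i) + μ
    IntegrableOn
      (fun t : Fin n → ℝ =>
        (∏ i, (t i : ℂ) ^ (lam i - 1)) * ((1 - ∑ i, t i : ℝ) : ℂ) ^ (μ - 1) *
          φ (t i0))
      (openSimplex n) ∧
    IntegrableOn
      (fun s : ℝ => (s : ℂ) ^ (lam i0 - 1) * ((1 - s : ℝ) : ℂ) ^ (ν - 1) * φ s)
      (Set.Ioo 0 1) ∧
    (1 / Complex.Gamma μ) *
        ∫ t in openSimplex n,
          (∏ i, (t i : ℂ) ^ (lam i - 1)) * ((1 - ∑ i, t i : ℝ) : ℂ) ^ (μ - 1) *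
            φ (t i0)
      = ((∏ i ∈ Finset.univ.erase i0, Complex.Gamma (lam i)) / Complex.Gamma ν) *
          ∫ s in Set.Ioo (0 : ℝ) 1,
            (s : ℂ) ^ (lam i0 - 1) * ((1 - s : ℝ) : ℂ) ^ (ν - 1) * φ s := by
  obtain ⟨m, rfl⟩ : ∃ m, n = m + 1 := ⟨n - 1, by omega⟩
  intro i0 ν
  have hi0 : i0 = 0 := rfl
  have hprod : ∏ i ∈ Finset.univ.erase i0, Complex.Gamma (lam i) =
      ∏ i : Fin m, Complex.Gamma (lam i.succ) := by
    rw [hi0, ← Finset.compl_singleton, ← Fin.image_succ_univ,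
      Finset.prod_image (Fin.succ_injective m).injOn]
  have hν : ν = ∑ i : Fin m, lam i.succ + μ := by
    simp only [ν]
    rw [hi0, ← Finset.compl_singleton, ← Fin.image_succ_univ,
      Finset.sum_image (Fin.succ_injective m).injOn]
  have hνre : 0 < ν.re := by
    rw [hν, add_re, re_sum]
    exact add_pos_of_nonneg_of_pos (Finset.sum_nonneg fun i _ => (hlam i.succ).le) hμ
  obtain ⟨h1, h2⟩ := (dirichletFormula m).succ_mul lam μ hlam hμ one_pos hφ
  refine ⟨h1, integrableOn_beta_mul (hlam i0) hνre one_pos hφ, ?_⟩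
  rw [← hν] at h2
  have hne := Gamma_ne_zero_of_re_pos hμ
  rw [hprod]
  refine (congrArg (1 / Complex.Gamma μ * ·) h2).trans ?_
  simp only [dirichletMass, ← hν]
  rw [← mul_assoc]
  congr 1
  field_simp
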